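/- arXiv:1107.0537 — 2 statements merged into one kernel-verified Lean document; each statement's English description precedes it below -/
import Mathlib

section
/- Every homogeneous polynomial f ∈ R whose total degree is strictly greater than 2rn − r − n lies in the ideal J. Equivalently, the multidegree-d component of R/J is zero whenever d_1 + … + d_ℓ > 2rn − r − n. -/
open scoped Classical

noncomputable section

/-- The polynomial ring `ℚ[x_{ij} : 1 ≤ i ≤ ℓ, 1 ≤ j ≤ n]`. -/
abbrev PolyR (ℓ n : ℕ) : Type := MvPolynomial (Fin ℓ × Fin n) ℚ

/-- The monomial quasi-invariant `M_A` attached to a matrix `A` given as a list of columns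
(each column a function `Fin ℓ → ℕ`): the sum over all strictly increasing choices of
columns of variables of the corresponding product of powers. -/
noncomputable def Mlist (n : ℕ) {ℓ : ℕ} (A : List (Fin ℓ → ℕ)) : PolyR ℓ n :=
  ∑ s ∈ Finset.univ.filter (fun s : Fin A.length → Fin n => StrictMono s),
    ∏ c : Fin A.length, ∏ i : Fin ℓ, MvPolynomial.X (i, s c) ^ (A.get c i)

/-- `A` (a list of columns) is an `r`-composition-matrix: it is nonempty and each column sum
is a positive multiple of `r`. -/
def IsRCompList (r : ℕ) {ℓ : ℕ} (A : List (Fin ℓ → ℕ)) : Prop :=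
  A ≠ [] ∧ ∀ V ∈ A, (∑ i, V i) ≠ 0 ∧ r ∣ (∑ i, V i)

/-- The ideal `J` generated by the monomial quasi-invariants `M_A`, for `A` an
`r`-composition-matrix with `ℓ` rows and at most `n` columns. -/
noncomputable def Jdeal (r n ℓ : ℕ) : Ideal (PolyR ℓ n) :=
  Ideal.span {f | ∃ A : List (Fin ℓ → ℕ), IsRCompList r A ∧ A.length ≤ n ∧ f = Mlist n A}

/-- The submodule of polynomials that are multihomogeneous of multidegree `d ∈ ℕ^ℓ`
(total degree `d i` in the `i`-th row of variables). -/
noncomputable def homogComp (ℓ n : ℕ) (d : Fin ℓ → ℕ) : Submodule ℚ (PolyR ℓ n) :=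
  MvPolynomial.weightedHomogeneousSubmodule ℚ (fun p : Fin ℓ × Fin n => Pi.single p.1 1) d

/-- The dimension over `ℚ` of the multidegree-`d` component of `R/J`, i.e. of the image of
the multihomogeneous component of degree `d` in the quotient by the ideal `J`. -/
noncomputable def compDim (r n ℓ : ℕ) (d : Fin ℓ → ℕ) : ℕ :=
  Module.finrank ℚ
    ↥((homogComp ℓ n d).map (Ideal.Quotient.mkₐ ℚ (Jdeal r n ℓ)).toLinearMap)


section PatternSums

variable {α S : Type*} [CommRing S]

/-- A word with marked letters `(a, s)`; the sum over the weakly increasing placements of its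
letters on the positions `j, …, j + m - 1` which strictly increase after each letter marked `true`
of the products of the values `φ i a`. -/
noncomputable def patternSum (φ : ℕ → α → S) : ℕ → ℕ → List (α × Bool) → S
  | _, _, [] => 1
  | _, 0, _ :: _ => 0
  | j, m + 1, (a, s) :: p =>
    patternSum φ (j + 1) m ((a, s) :: p) +
      φ j a * if s then patternSum φ (j + 1) m p else patternSum φ j (m + 1) p
termination_by _ m p => (m, p.length)

theorem patternSum_nil (φ : ℕ → α → S) (j m : ℕ) : patternSum φ j m [] = 1 := by
  rw [patternSum]

theorem patternSum_zero_cons (φ : ℕ → α → S) (j : ℕ) (x : α × Bool) (p : List (α × Bool)) :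
    patternSum φ j 0 (x :: p) = 0 := by
  rw [patternSum]

theorem patternSum_succ_cons (φ : ℕ → α → S) (j m : ℕ) (a : α) (s : Bool) (p : List (α × Bool)) :
    patternSum φ j (m + 1) ((a, s) :: p) = patternSum φ (j + 1) m ((a, s) :: p) +
      φ j a * if s then patternSum φ (j + 1) m p else patternSum φ j (m + 1) p := by
  rw [patternSum]

/-- The number of blocks of a marked word, a block ending at a letter marked `true` or at the end
of the word. -/
def blockCount : List (α × Bool) → ℕ
  | [] => 0
  | (_, s) :: p => blockCount p + if s ∨ p = [] then 1 else 0

/-- The word `v` as a single block. -/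
def singleBlock : List α → List (α × Bool)
  | [] => []
  | [a] => [(a, true)]
  | a :: b :: v => (a, false) :: singleBlock (b :: v)

theorem length_singleBlock : ∀ v : List α, (singleBlock v).length = v.length
  | [] => rfl
  | [_] => rfl
  | _ :: b :: v => by simp [singleBlock, length_singleBlock (b :: v)]

theorem blockCount_singleBlock_append (p : List (α × Bool)) :
    ∀ v : List α, v ≠ [] → blockCount (singleBlock v ++ p) = blockCount p + 1
  | [], h => absurd rfl h
  | [_], _ => by simp [singleBlock, blockCount]
  | _ :: b :: v, _ => by
    have h : singleBlock (b :: v) ≠ [] := by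
      rw [Ne, ← List.length_eq_zero_iff, length_singleBlock]; simp
    simp [singleBlock, blockCount, h, blockCount_singleBlock_append p (b :: v)]

/-- The product of the values at position `j < n` of the letters in `U j`. -/
def letterProd (φ : ℕ → α → S) (n : ℕ) (U : ℕ → Multiset α) : S :=
  ∏ j ∈ Finset.range n, ((U j).map (φ j)).prod

/-- Insert the letter `a` at position `k`. -/
def addLetter (U : ℕ → Multiset α) (k : ℕ) (a : α) : ℕ → Multiset α :=
  Function.update U k (a ::ₘ U k)

theorem addLetter_self (U : ℕ → Multiset α) (k : ℕ) (a : α) :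
    addLetter U k a k = a ::ₘ U k := by
  simp [addLetter]

theorem addLetter_of_ne (U : ℕ → Multiset α) {k j : ℕ} (a : α) (h : j ≠ k) :
    addLetter U k a j = U j := by
  simp [addLetter, h]

theorem letterProd_addLetter (φ : ℕ → α → S) {n k : ℕ} (hk : k < n) (U : ℕ → Multiset α)
    (a : α) : letterProd φ n (addLetter U k a) = letterProd φ n U * φ k a := by
  have hk' : k ∈ Finset.range n := Finset.mem_range.2 hk
  have h : ∏ j ∈ Finset.range n \ {k}, ((addLetter U k a j).map (φ j)).prod =
      ∏ j ∈ Finset.range n \ {k}, ((U j).map (φ j)).prod :=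
    Finset.prod_congr rfl fun j hj => by
      rw [addLetter_of_ne _ _ (by simpa using (Finset.mem_sdiff.1 hj).2)]
  rw [letterProd, letterProd, Finset.prod_eq_mul_prod_sdiff_singleton_of_mem hk',
    Finset.prod_eq_mul_prod_sdiff_singleton_of_mem hk', h, addLetter_self, Multiset.map_cons,
    Multiset.prod_cons]
  ring

theorem sum_card_addLetter {n k : ℕ} (hk : k < n) (U : ℕ → Multiset α) (a : α) :
    ∑ j ∈ Finset.range n, (addLetter U k a j).card =
      ∑ j ∈ Finset.range n, (U j).card + 1 := by
  have hk' : k ∈ Finset.range n := Finset.mem_range.2 hk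
  have h : ∑ j ∈ Finset.range n \ {k}, (addLetter U k a j).card =
      ∑ j ∈ Finset.range n \ {k}, (U j).card :=
    Finset.sum_congr rfl fun j hj => by
      rw [addLetter_of_ne _ _ (by simpa using (Finset.mem_sdiff.1 hj).2)]
  rw [Finset.sum_eq_add_sum_sdiff_singleton_of_mem hk',
    Finset.sum_eq_add_sum_sdiff_singleton_of_mem hk', h, addLetter_self, Multiset.card_cons]
  ring

/-- The sequence of cardinalities of `V` is lexicographically smaller than that of `U`, the first
difference being at `k`. -/
def LexLowerAt (U V : ℕ → Multiset α) (k : ℕ) : Prop :=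
  (V k).card < (U k).card ∧ ∀ i < k, (V i).card = (U i).card

theorem LexLowerAt.addLetter {U V : ℕ → Multiset α} {k j : ℕ} (h : LexLowerAt U V k)
    (hkj : k < j) (a : α) : LexLowerAt U (addLetter V j a) k := by
  refine ⟨?_, fun i hi => ?_⟩
  · rw [addLetter_of_ne _ _ hkj.ne]; exact h.1
  · rw [addLetter_of_ne _ _ (hi.trans hkj).ne]; exact h.2 i hi

variable {φ : ℕ → α → S} {n N : ℕ} {I : Ideal S} {U : ℕ → Multiset α}

theorem letterProd_mul_patternSum_mem_of_lexLowerAt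
    (hlow : ∀ V : ℕ → Multiset α, ∑ j ∈ Finset.range n, (V j).card = N →
      (∃ k < n, LexLowerAt U V k) → letterProd φ n V ∈ I) (j m : ℕ) (p : List (α × Bool)) :
    ∀ (V : ℕ → Multiset α) (k : ℕ), j + m = n → k < j → k < n → LexLowerAt U V k →
      ∑ i ∈ Finset.range n, (V i).card + p.length = N →
      letterProd φ n V * patternSum φ j m p ∈ I := by
  induction j, m, p using patternSum.induct with
  | case1 j m =>
    intro V k _ _ hk hV hN
    rw [patternSum_nil, mul_one]
    exact hlow V (by simpa using hN) ⟨k, hk, hV⟩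
  | case2 j x p =>
    intros
    simp [patternSum_zero_cons]
  | case3 j m a s p ih₁ ih₂ ih₃ =>
    intro V k hjm hkj hk hV hN
    have hN' : ∑ i ∈ Finset.range n, (addLetter V j a i).card + p.length = N := by
      rw [sum_card_addLetter (by omega)]
      simp only [List.length_cons] at hN
      omega
    rw [patternSum_succ_cons, mul_add, ← mul_assoc, ← letterProd_addLetter φ (by omega)]
    refine I.add_mem (ih₁ V k (by omega) (by omega) hk hV hN) ?_
    split_ifs
    · exact ih₂ _ k (by omega) (by omega) hk (hV.addLetter hkj a) hN'
    · exact ih₃ _ k (by omega) (by omega) hk (hV.addLetter hkj a) hN'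

theorem letterProd_mul_patternSum_mem_of_singleBlock
    (hlow : ∀ V : ℕ → Multiset α, ∑ j ∈ Finset.range n, (V j).card = N →
      (∃ k < n, LexLowerAt U V k) → letterProd φ n V ∈ I) {k m : ℕ} (hkm : k + (m + 1) = n)
    {W : ℕ → Multiset α} (hWU : ∀ i ≤ k, W i = U i) {p : List (α × Bool)}
    (hN : ∑ i ∈ Finset.range n, (W i).card + p.length = N) :
    ∀ (v : List α) (V : ℕ → Multiset α), v ≠ [] → (∀ i, i ≠ k → V i = W i) →
      V k + (v : Multiset α) = W k →
      letterProd φ n V * patternSum φ k (m + 1) (singleBlock v ++ p) ∈ I →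
      letterProd φ n W * patternSum φ (k + 1) m p ∈ I := by
  have lower (V : ℕ → Multiset α) (a : α) (v : List α) (hVW : ∀ i, i ≠ k → V i = W i)
      (hV : V k + ((a :: v : List α) : Multiset α) = W k) : LexLowerAt U V k := by
    refine ⟨?_, fun i hi => by rw [hVW i hi.ne, hWU i hi.le]⟩
    rw [← hWU k le_rfl, ← hV]
    simp
  have total (V : ℕ → Multiset α) (v : List α) (hVW : ∀ i, i ≠ k → V i = W i)
      (hV : V k + (v : Multiset α) = W k) :
      ∑ i ∈ Finset.range n, (V i).card + (v.length + p.length) = N := by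
    have hk' : k ∈ Finset.range n := Finset.mem_range.2 (by omega)
    have h : ∑ j ∈ Finset.range n \ {k}, (V j).card = ∑ j ∈ Finset.range n \ {k}, (W j).card :=
      Finset.sum_congr rfl fun j hj => by rw [hVW j (by simpa using (Finset.mem_sdiff.1 hj).2)]
    rw [Finset.sum_eq_add_sum_sdiff_singleton_of_mem hk', ← hV, Multiset.card_add,
      Multiset.coe_card] at hN
    rw [Finset.sum_eq_add_sum_sdiff_singleton_of_mem hk', h]
    omega
  intro v
  induction v with
  | nil => exact fun _ h => absurd rfl h
  | cons a v ih =>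
    intro V _ hVW hV hmem
    have hrest (q : List (α × Bool)) (hq : q.length = v.length + 1 + p.length) :
        letterProd φ n V * patternSum φ (k + 1) m q ∈ I :=
      letterProd_mul_patternSum_mem_of_lexLowerAt hlow _ _ _ V k (by omega) (by omega) (by omega)
        (lower V a v hVW hV) (by rw [hq]; exact total V (a :: v) hVW hV)
    have hVW' : ∀ i, i ≠ k → addLetter V k a i = W i := fun i hi => by
      rw [addLetter_of_ne _ _ hi, hVW i hi]
    have hV' : addLetter V k a k + (v : Multiset α) = W k := by
      rw [addLetter_self, ← hV, ← Multiset.cons_coe, Multiset.cons_add, Multiset.add_cons]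
    cases v with
    | nil =>
      rw [singleBlock, List.cons_append, List.nil_append, patternSum_succ_cons, mul_add,
        if_pos rfl, ← mul_assoc, ← letterProd_addLetter φ (by omega)] at hmem
      have hW : addLetter V k a = W := by
        funext i
        by_cases hi : i = k
        · subst hi; simpa using hV'
        · exact hVW' i hi
      rw [hW] at hmem
      exact (I.add_mem_iff_right (hrest _ (by simp; omega))).1 hmem
    | cons b v =>
      rw [singleBlock, List.cons_append, patternSum_succ_cons, mul_add,
        if_neg (by simp), ← mul_assoc, ← letterProd_addLetter φ (by omega)] at hmem
      refine ih _ (by simp) hVW' hV' ((I.add_mem_iff_right (hrest _ ?_)).1 hmem)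
      simp [length_singleBlock]
      omega

theorem letterProd_mul_patternSum_mem
    (hlow : ∀ V : ℕ → Multiset α, ∑ j ∈ Finset.range n, (V j).card = N →
      (∃ k < n, LexLowerAt U V k) → letterProd φ n V ∈ I)
    (hI : ∀ p : List (α × Bool), p ≠ [] → patternSum φ 0 n p ∈ I) (k : ℕ) :
    ∀ (m : ℕ) (p : List (α × Bool)) (W : ℕ → Multiset α), k + m = n →
      (∀ i < k, U i ≠ 0 → ∀ j ≤ i, W j = U j) →
      ∑ i ∈ Finset.range n, (W i).card + p.length = N →
      k + blockCount p ≤ ∑ i ∈ Finset.range k, (U i).card + p.length →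
      1 ≤ ∑ i ∈ Finset.range k, (U i).card + p.length →
      letterProd φ n W * patternSum φ k m p ∈ I := by
  induction k with
  | zero =>
    intro m p W hm _ _ _ hp
    obtain rfl : m = n := by omega
    refine I.mul_mem_left _ (hI p ?_)
    rintro rfl
    simp at hp
  | succ k ih =>
    intro m p
    by_cases hU : U k = 0
    · have he : ∑ i ∈ Finset.range (k + 1), (U i).card = ∑ i ∈ Finset.range k, (U i).card := by
        simp [Finset.sum_range_succ, hU]
      rw [he]
      induction p with
      | nil =>
        intro W hm hW hN hb hp
        have := ih (m + 1) [] W (by omega) (fun i hi => hW i (by omega)) hN (by omega) hp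
        rwa [patternSum_nil] at this ⊢
      | cons x p ihp =>
        obtain ⟨a, s⟩ := x
        intro W hm hW hN hb hp
        have hW' : ∀ i < k + 1, U i ≠ 0 → ∀ j ≤ i, addLetter W k a j = U j := by
          intro i hi hUi j hj
          have hik : i ≠ k := by rintro rfl; exact hUi hU
          rw [addLetter_of_ne _ _ (by omega), hW i hi hUi j hj]
        have hN' : ∑ i ∈ Finset.range n, (addLetter W k a i).card + p.length = N := by
          rw [sum_card_addLetter (by omega)]
          simp only [List.length_cons] at hN
          omega
        simp only [blockCount, List.length_cons] at hb
        have hmem := ih (m + 1) ((a, s) :: p) W (by omega) (fun i hi => hW i (by omega)) hN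
          (by simp only [blockCount, List.length_cons]; omega) hp
        rw [patternSum_succ_cons, mul_add, ← mul_assoc, ← letterProd_addLetter φ (by omega)]
          at hmem
        refine (I.add_mem_iff_left ?_).1 hmem
        by_cases hs : s = true
        · rw [if_pos (Or.inl hs)] at hb
          rw [if_pos hs]
          exact ihp _ hm hW' hN' (by omega) (by omega)
        · rw [if_neg hs]
          by_cases hp' : p = []
          · subst hp'
            rw [if_pos (Or.inr rfl)] at hb
            have := ihp _ hm hW' hN' (by omega) (by omega)
            rwa [patternSum_nil] at this ⊢
          · rw [if_neg (by tauto)] at hb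
            have := List.length_pos_iff.2 hp'
            exact ih (m + 1) p _ (by omega) (fun i hi => hW' i (by omega)) hN' (by omega)
              (by omega)
    · intro W hm hW hN hb hp
      have hWU : ∀ i ≤ k, W i = U i := hW k (by omega) hU
      obtain ⟨v, hv⟩ := Quot.exists_rep (U k)
      replace hv : (v : Multiset α) = U k := hv
      have hv0 : v ≠ [] := by rintro rfl; exact hU hv.symm
      have hvc : (U k).card = v.length := by rw [← hv, Multiset.coe_card]
      have hV : ∀ i, i ≠ k → Function.update W k 0 i = W i := fun i hi => by simp [hi]
      refine letterProd_mul_patternSum_mem_of_singleBlock hlow (by omega) hWU hN v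
        (Function.update W k 0) hv0 hV (by simp [hv, hWU]) ?_
      have hk' : k ∈ Finset.range n := Finset.mem_range.2 (by omega)
      have hsum : ∑ j ∈ Finset.range n \ {k}, (Function.update W k 0 j).card =
          ∑ j ∈ Finset.range n \ {k}, (W j).card :=
        Finset.sum_congr rfl fun j hj => by rw [hV j (by simpa using (Finset.mem_sdiff.1 hj).2)]
      rw [Finset.sum_range_succ, hvc] at hb hp
      refine ih (m + 1) _ _ (by omega) (fun i hi _ j hj => ?_) ?_ ?_ ?_
      · rw [hV j (by omega), hWU j (by omega)]
      · rw [Finset.sum_eq_add_sum_sdiff_singleton_of_mem hk', hWU k le_rfl, hvc] at hN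
        rw [Finset.sum_eq_add_sum_sdiff_singleton_of_mem hk', hsum, List.length_append,
          length_singleBlock, Function.update_self, Multiset.card_zero]
        omega
      · rw [blockCount_singleBlock_append p v hv0, List.length_append, length_singleBlock]
        omega
      · rw [List.length_append, length_singleBlock]
        omega

/-- If an ideal contains all pattern sums of nonempty words on `n ≥ 1` positions, then it contains
every product of at least `n` letters. -/
theorem letterProd_mem (hn : 1 ≤ n)
    (hI : ∀ p : List (α × Bool), p ≠ [] → patternSum φ 0 n p ∈ I) (U : ℕ → Multiset α)
    (hU : n ≤ ∑ j ∈ Finset.range n, (U j).card) : letterProd φ n U ∈ I := by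
  let shape (U : ℕ → Multiset α) : Lex (Fin n → ℕ) := toLex fun j => (U j).card
  have wf : WellFounded fun V U : ℕ → Multiset α => shape V < shape U :=
    InvImage.wf shape wellFounded_lt
  induction U using wf.induction with
  | h U ih =>
    have hlow : ∀ V : ℕ → Multiset α,
        ∑ j ∈ Finset.range n, (V j).card = ∑ j ∈ Finset.range n, (U j).card →
        (∃ k < n, LexLowerAt U V k) → letterProd φ n V ∈ I := by
      rintro V hV ⟨k, hk, hlt, heq⟩
      exact ih V ⟨⟨k, hk⟩, fun j hj => heq j hj, hlt⟩ (hV ▸ hU)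
    have := letterProd_mul_patternSum_mem hlow hI n 0 [] U rfl (fun _ _ _ _ _ => rfl) (by simp)
      (by simpa [blockCount] using hU) (by simp only [List.length_nil]; omega)
    rwa [patternSum_nil, mul_one] at this

end PatternSums

section StrictPatterns

variable {α S : Type*} [CommRing S] {φ : ℕ → α → S}

/-- The word all of whose letters are marked `true`. -/
def strictWord (A : List α) : List (α × Bool) := A.map fun a => (a, true)

theorem patternSum_singleton (a : α) (s : Bool) (m : ℕ) :
    ∀ j, patternSum φ j m [(a, s)] = patternSum φ j m [(a, true)] := by
  induction m with
  | zero => intro j; simp [patternSum_zero_cons]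
  | succ m ih => intro j; simp [patternSum_succ_cons, patternSum_nil, ih]

theorem patternSum_merge {a b c : α} (hc : ∀ j, φ j c = φ j a * φ j b) (s : Bool)
    (p : List (α × Bool)) (m : ℕ) : ∀ j,
    patternSum φ j m ((a, false) :: (b, s) :: p) =
      patternSum φ j m ((a, true) :: (b, s) :: p) + patternSum φ j m ((c, s) :: p) := by
  induction m with
  | zero => intro j; simp [patternSum_zero_cons]
  | succ m ih =>
    intro j
    rw [patternSum_succ_cons, ih, patternSum_succ_cons _ _ _ a true,
      patternSum_succ_cons _ _ _ c, if_neg (by simp), if_pos rfl, patternSum_succ_cons _ _ _ b, hc]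
    ring

theorem patternSum_strictWord_append_add {q q₁ q₂ : List (α × Bool)}
    (h : ∀ m j, patternSum φ j m q = patternSum φ j m q₁ + patternSum φ j m q₂) (A : List α) :
    ∀ m j, patternSum φ j m (strictWord A ++ q) =
      patternSum φ j m (strictWord A ++ q₁) + patternSum φ j m (strictWord A ++ q₂) := by
  induction A with
  | nil => exact h
  | cons a A ih =>
    intro m
    induction m with
    | zero => intro j; simp [strictWord, patternSum_zero_cons]
    | succ m ihm =>
      intro j
      have h₁ := ihm (j + 1)
      have h₂ := ih m (j + 1)
      simp only [strictWord, List.map_cons, List.cons_append, patternSum_succ_cons, if_true]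
        at h₁ h₂ ⊢
      rw [h₁, h₂]
      ring

theorem patternSum_strictWord_append_singleton (a : α) (s : Bool) (A : List α) :
    ∀ m j, patternSum φ j m (strictWord A ++ [(a, s)]) =
      patternSum φ j m (strictWord (A ++ [a])) := by
  induction A with
  | nil => intro m j; exact patternSum_singleton a s m j
  | cons b A ih =>
    intro m
    induction m with
    | zero => intro j; simp [strictWord, patternSum_zero_cons]
    | succ m ihm =>
      intro j
      have h₁ := ihm (j + 1)
      have h₂ := ih m (j + 1)
      simp only [strictWord, List.map_cons, List.cons_append, patternSum_succ_cons, if_true]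
        at h₁ h₂ ⊢
      rw [h₁, h₂]

/-- An ideal containing the pattern sums of all strict words contains those of all words. -/
theorem patternSum_mem_of_strictWord_mem
    (hmul : ∀ a b : α, ∃ c, ∀ j, φ j c = φ j a * φ j b) {I : Ideal S} {n : ℕ}
    (hI : ∀ A : List α, A ≠ [] → patternSum φ 0 n (strictWord A) ∈ I)
    (p : List (α × Bool)) (hp : p ≠ []) : patternSum φ 0 n p ∈ I := by
  have key : ∀ (k : ℕ) (p : List (α × Bool)) (A : List α), p.length = k →
      strictWord A ++ p ≠ [] → patternSum φ 0 n (strictWord A ++ p) ∈ I := by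
    intro k
    induction k with
    | zero =>
      intro p A hk h
      obtain rfl := List.length_eq_zero_iff.1 hk
      rw [List.append_nil] at h ⊢
      exact hI A fun hA => h (by simp [hA, strictWord])
    | succ k ih =>
      have strict (a : α) (p : List (α × Bool)) (A : List α) (hk : p.length = k) :
          patternSum φ 0 n (strictWord A ++ (a, true) :: p) ∈ I := by
        have := ih p (A ++ [a]) hk (by simp [strictWord])
        simpa [strictWord] using this
      intro p A hk h
      match p, hk with
      | (a, true) :: p, hk => exact strict a p A (by simpa using hk)
      | [(a, false)], _ =>
        rw [patternSum_strictWord_append_singleton]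
        exact hI _ (by simp)
      | (a, false) :: (b, s) :: p, hk =>
        obtain ⟨c, hc⟩ := hmul a b
        rw [patternSum_strictWord_append_add (fun m j => patternSum_merge hc s p m j)]
        exact I.add_mem (strict a _ A (by simpa using hk))
          (ih _ A (by simpa using hk) (by simp))
  exact key p.length p [] rfl hp

end StrictPatterns

section QuasiInvariants

variable {ℓ n : ℕ}

/-- The monomial `X_j ^ V`, with value `1` for `j` out of range. -/
def columnMonomial (ℓ n : ℕ) (j : ℕ) (V : Fin ℓ → ℕ) : PolyR ℓ n :=
  if h : j < n then ∏ i, MvPolynomial.X (i, ⟨j, h⟩) ^ V i else 1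

theorem columnMonomial_val (j : Fin n) (V : Fin ℓ → ℕ) :
    columnMonomial ℓ n j V = ∏ i, MvPolynomial.X (i, j) ^ V i := by
  simp [columnMonomial]

theorem columnMonomial_add (j : ℕ) (V W : Fin ℓ → ℕ) :
    columnMonomial ℓ n j (V + W) = columnMonomial ℓ n j V * columnMonomial ℓ n j W := by
  unfold columnMonomial
  split_ifs <;> simp [pow_add, Finset.prod_mul_distrib]

/-- The part of `Mlist n A` supported on the columns of variables from `j` on. -/
def tailMlist (n : ℕ) (j : ℕ) (A : List (Fin ℓ → ℕ)) : PolyR ℓ n :=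
  ∑ s : Fin A.length → Fin n, if StrictMono s ∧ ∀ c, j ≤ s c then
    ∏ c, columnMonomial ℓ n (s c) (A.get c) else 0

theorem tailMlist_zero (A : List (Fin ℓ → ℕ)) : tailMlist n 0 A = Mlist n A := by
  simp only [tailMlist, Mlist, Finset.sum_filter, columnMonomial_val, zero_le, implies_true,
    and_true]

theorem tailMlist_nil (j : ℕ) : tailMlist n j ([] : List (Fin ℓ → ℕ)) = 1 := by
  have h : ∀ s : Fin ([] : List (Fin ℓ → ℕ)).length → Fin n,
      StrictMono s ∧ ∀ c, j ≤ (s c : ℕ) :=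
    fun s => ⟨fun a => a.elim0, fun a => a.elim0⟩
  rw [tailMlist, Finset.sum_congr rfl fun s _ => if_pos (h s)]
  simp

theorem strictMono_cons_iff {k : ℕ} (j : ℕ) (i : Fin n) (s : Fin k → Fin n) :
    (StrictMono (Fin.cons i s : Fin (k + 1) → Fin n) ∧
      ∀ c, j ≤ ((Fin.cons i s : Fin (k + 1) → Fin n) c : ℕ)) ↔
    j ≤ i ∧ StrictMono s ∧ ∀ c, (i : ℕ) + 1 ≤ s c := by
  constructor
  · rintro ⟨h, hj⟩
    refine ⟨hj 0, fun a b hab => ?_, fun c => ?_⟩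
    · simpa using h (Fin.succ_lt_succ_iff.2 hab)
    · have := h (Fin.succ_pos c)
      rwa [Fin.cons_zero, Fin.cons_succ, Fin.lt_def] at this
  · rintro ⟨hj, h, hi⟩
    refine ⟨fun a b hab => ?_, fun c => ?_⟩
    · induction b using Fin.cases with
      | zero => exact absurd hab (Fin.not_lt_zero a)
      | succ b =>
        induction a using Fin.cases with
        | zero =>
          rw [Fin.cons_zero, Fin.cons_succ, Fin.lt_def]
          exact hi b
        | succ a => simpa using h (Fin.succ_lt_succ_iff.1 hab)
    · induction c using Fin.cases with
      | zero => simpa using hj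
      | succ c =>
        have := hi c
        simp only [Fin.cons_succ]
        omega

theorem tailMlist_cons (j : ℕ) (V : Fin ℓ → ℕ) (A : List (Fin ℓ → ℕ)) :
    tailMlist n j (V :: A) =
      ∑ i : Fin n, if j ≤ i then columnMonomial ℓ n i V * tailMlist n (i + 1) A else 0 := by
  rw [tailMlist]
  change ∑ s : Fin (A.length + 1) → Fin n, _ = _
  rw [← (Fin.consEquiv fun _ : Fin (A.length + 1) => Fin n).sum_comp, Fintype.sum_prod_type]
  refine Finset.sum_congr rfl fun i _ => ?_
  rw [tailMlist, Finset.mul_sum]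
  by_cases hji : j ≤ i
  · rw [if_pos hji]
    refine Finset.sum_congr rfl fun s _ => ?_
    rw [mul_ite, mul_zero]
    refine if_congr ((strictMono_cons_iff j i s).trans (and_iff_right hji)) ?_ rfl
    exact Fin.prod_univ_succ _
  · rw [if_neg hji]
    exact Finset.sum_eq_zero fun s _ => if_neg fun h =>
      hji ((strictMono_cons_iff j i s).1 h).1

theorem tailMlist_cons_of_le {j : ℕ} (hj : n ≤ j) (V : Fin ℓ → ℕ) (A : List (Fin ℓ → ℕ)) :
    tailMlist n j (V :: A) = 0 := by
  rw [tailMlist_cons]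
  exact Finset.sum_eq_zero fun i _ => if_neg (by omega)

theorem tailMlist_cons_of_lt {j : ℕ} (hj : j < n) (V : Fin ℓ → ℕ) (A : List (Fin ℓ → ℕ)) :
    tailMlist n j (V :: A) =
      tailMlist n (j + 1) (V :: A) + columnMonomial ℓ n j V * tailMlist n (j + 1) A := by
  have h : ∀ i : Fin n,
      (if j ≤ i then columnMonomial ℓ n i V * tailMlist n (i + 1) A else 0) =
        (if j + 1 ≤ i then columnMonomial ℓ n i V * tailMlist n (i + 1) A else 0) +
          if i = ⟨j, hj⟩ then columnMonomial ℓ n j V * tailMlist n (j + 1) A else 0 := by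
    intro i
    rcases lt_trichotomy (i : ℕ) j with hi | hi | hi
    · rw [if_neg (by omega), if_neg (by omega), if_neg (by rintro rfl; simp at hi), add_zero]
    · rw [if_pos hi.ge, if_neg (by omega), if_pos (Fin.ext hi), hi, zero_add]
    · rw [if_pos hi.le, if_pos (Nat.succ_le_of_lt hi), if_neg (by rintro rfl; simp at hi), add_zero]
  rw [tailMlist_cons, tailMlist_cons, Finset.sum_congr rfl fun i _ => h i,
    Finset.sum_add_distrib, Finset.sum_ite_eq' Finset.univ, if_pos (Finset.mem_univ _)]

theorem patternSum_strictWord {α : Type*} (c : α → Fin ℓ → ℕ) (A : List α) :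
    ∀ m j, j + m = n → patternSum (fun j a => columnMonomial ℓ n j (c a)) j m (strictWord A) =
      tailMlist n j (A.map c) := by
  induction A with
  | nil => intro m j _; simp [strictWord, patternSum_nil, tailMlist_nil]
  | cons a A ih =>
    intro m
    induction m with
    | zero =>
      intro j hj
      simp only [strictWord, List.map_cons, patternSum_zero_cons]
      rw [tailMlist_cons_of_le (by omega)]
    | succ m ihm =>
      intro j hj
      have h₁ := ihm (j + 1) (by omega)
      have h₂ := ih m (j + 1) (by omega)
      simp only [strictWord, List.map_cons, patternSum_succ_cons, if_true] at h₁ h₂ ⊢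
      rw [h₁, h₂, tailMlist_cons_of_lt (j := j) (by omega)]

theorem Mlist_eq_zero {A : List (Fin ℓ → ℕ)} (h : n < A.length) : Mlist n A = 0 := by
  rw [Mlist, Finset.filter_eq_empty_iff.2, Finset.sum_empty]
  intro s _ hs
  have := Fintype.card_le_of_injective s hs.injective
  simp only [Fintype.card_fin] at this
  omega

/-- The columns whose sum is a positive multiple of `r`. -/
abbrev RColumn (r ℓ : ℕ) : Type := {V : Fin ℓ → ℕ // (∑ i, V i) ≠ 0 ∧ r ∣ ∑ i, V i}

theorem patternSum_mem_Jdeal (r : ℕ) (p : List (RColumn r ℓ × Bool)) (hp : p ≠ []) :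
    patternSum (fun j (V : RColumn r ℓ) => columnMonomial ℓ n j V) 0 n p ∈ Jdeal r n ℓ := by
  have hsum (V W : Fin ℓ → ℕ) : ∑ i, (V + W) i = ∑ i, V i + ∑ i, W i :=
    Finset.sum_add_distrib
  refine patternSum_mem_of_strictWord_mem (fun V W => ⟨⟨V.1 + W.1, ?_⟩,
    fun j => columnMonomial_add j V.1 W.1⟩) (fun A hA => ?_) p hp
  · rw [patternSum_strictWord (fun V : RColumn r ℓ => (V : Fin ℓ → ℕ)) A n 0 (zero_add n),
      tailMlist_zero]
    by_cases hlen : (A.map fun V : RColumn r ℓ => (V : Fin ℓ → ℕ)).length ≤ n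
    · refine Ideal.subset_span ⟨_, ⟨fun h => hA (List.map_eq_nil_iff.1 h), fun V hV => ?_⟩, hlen, rfl⟩
      obtain ⟨W, _, rfl⟩ := List.mem_map.1 hV
      exact W.2
    · rw [Mlist_eq_zero (by omega)]
      exact Ideal.zero_mem _
  · rw [hsum]
    exact ⟨fun h => V.2.1 (Nat.eq_zero_of_add_eq_zero_right h), dvd_add V.2.2 W.2.2⟩

theorem exists_le_sum_eq {ι : Type*} [Fintype ι] (v : ι → ℕ) (t : ℕ) (ht : t ≤ ∑ i, v i) :
    ∃ w ≤ v, ∑ i, w i = t := by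
  induction t with
  | zero => exact ⟨0, fun _ => Nat.zero_le _, by simp⟩
  | succ t ih =>
    obtain ⟨w, hw, hsum⟩ := ih (by omega)
    obtain ⟨i, _, hi⟩ := Finset.exists_lt_of_sum_lt (show ∑ i, w i < ∑ i, v i by omega)
    refine ⟨w + Pi.single i 1, fun k => ?_, by simp [Finset.sum_add_distrib, hsum]⟩
    by_cases hk : k = i
    · subst hk; simpa using hi
    · simpa [hk] using hw k

theorem exists_multiset_rColumn {r : ℕ} (hr : 1 ≤ r) (q : ℕ) :
    ∀ v : Fin ℓ → ℕ, q * r ≤ ∑ i, v i →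
      ∃ s : Multiset (RColumn r ℓ), s.card = q ∧ (s.map Subtype.val).sum ≤ v := by
  induction q with
  | zero => exact fun v _ => ⟨0, rfl, fun _ => Nat.zero_le _⟩
  | succ q ih =>
    intro v hv
    rw [Nat.succ_mul] at hv
    obtain ⟨w, hw, hsum⟩ := exists_le_sum_eq v r (by omega)
    have hsub : ∑ i, (v - w) i + ∑ i, w i = ∑ i, v i := by
      rw [← Finset.sum_add_distrib]
      exact Finset.sum_congr rfl fun i _ => Nat.sub_add_cancel (hw i)
    obtain ⟨s, hs, hle⟩ := ih (v - w) (by omega)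
    refine ⟨⟨w, by omega, by rw [hsum]⟩ ::ₘ s, by simp [hs], ?_⟩
    rw [Multiset.map_cons, Multiset.sum_cons]
    intro i
    have h₁ := hle i
    have h₂ : w i ≤ v i := hw i
    simp only [Pi.sub_apply, Pi.add_apply] at h₁ ⊢
    omega

theorem prod_map_columnMonomial {r : ℕ} (j : Fin n) (s : Multiset (RColumn r ℓ)) :
    (s.map fun V : RColumn r ℓ => columnMonomial ℓ n j V.1).prod =
      ∏ i, MvPolynomial.X (i, j) ^ (s.map Subtype.val).sum i := by
  rw [← columnMonomial_val]
  induction s using Multiset.induction_on with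
  | empty => simp [columnMonomial_val]
  | cons V s ih =>
    rw [Multiset.map_cons, Multiset.prod_cons, ih, Multiset.map_cons, Multiset.sum_cons,
      columnMonomial_add]

theorem monomial_mem_Jdeal {r : ℕ} (hr : 1 ≤ r) (hn : 1 ≤ n) (E : Fin ℓ × Fin n →₀ ℕ)
    (hE : 2 * r * n - r - n < ∑ p, E p) (a : ℚ) : MvPolynomial.monomial E a ∈ Jdeal r n ℓ := by
  have hcol (j : Fin n) := exists_multiset_rColumn hr ((∑ i, E (i, j)) / r) (fun i => E (i, j))
    (Nat.div_mul_le_self _ _)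
  choose s hs hle using hcol
  let U : ℕ → Multiset (RColumn r ℓ) := fun j => if h : j < n then s ⟨j, h⟩ else 0
  have hU (j : Fin n) : U j = s j := by simp [U]
  have hcard : n ≤ ∑ j ∈ Finset.range n, (U j).card := by
    rw [Finset.sum_range, Finset.sum_congr rfl fun j _ => by rw [hU, hs j]]
    rw [Fintype.sum_prod_type_right] at hE
    have hdiv : ∑ j : Fin n, ∑ i, E (i, j) ≤
        ∑ j : Fin n, (r * ((∑ i, E (i, j)) / r) + (r - 1)) :=
      Finset.sum_le_sum fun j _ => by
        have h₁ := Nat.div_add_mod (∑ i, E (i, j)) r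
        have h₂ := Nat.mod_lt (∑ i, E (i, j)) hr
        omega
    rw [Finset.sum_add_distrib, ← Finset.mul_sum, Finset.sum_const, Finset.card_univ,
      Fintype.card_fin, smul_eq_mul] at hdiv
    by_contra! hlt
    obtain ⟨r, rfl⟩ := Nat.exists_eq_add_of_le' hr
    obtain ⟨n, rfl⟩ := Nat.exists_eq_add_of_le' hn
    have h₃ := Nat.mul_le_mul_left (r + 1) (Nat.le_of_lt_succ hlt)
    have h₄ : 2 * (r + 1) * (n + 1) - (r + 1) - (n + 1) = (r + 1) * n + (n + 1) * r := by
      rw [Nat.sub_sub]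
      refine Nat.sub_eq_of_eq_add ?_
      ring
    rw [h₄] at hE
    rw [Nat.add_sub_cancel] at hdiv
    omega
  have hmem := letterProd_mem hn (patternSum_mem_Jdeal r) U hcard
  rw [MvPolynomial.monomial_eq]
  refine Ideal.mul_mem_left _ _ (Ideal.mem_of_dvd _ ?_ hmem)
  rw [Finsupp.prod_fintype _ _ (by simp), Fintype.prod_prod_type_right, letterProd,
    Finset.prod_range]
  refine Finset.prod_dvd_prod_of_dvd _ _ fun j _ => ?_
  rw [hU, prod_map_columnMonomial]
  exact Finset.prod_dvd_prod_of_dvd _ _ fun i _ => pow_dvd_pow _ (hle j i)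

end QuasiInvariants

/-- Every multihomogeneous polynomial whose total degree exceeds
`2rn - r - n` lies in the ideal `J`; equivalently the multidegree-`d` component of `R/J`
vanishes when `d₁ + … + d_ℓ > 2rn - r - n`. -/
theorem statement1 (r n ℓ : ℕ) (hr : 1 ≤ r) (hn : 1 ≤ n) (hℓ : 1 ≤ ℓ)
    (d : Fin ℓ → ℕ) (hd : 2 * r * n - r - n < ∑ i, d i) :
    ∀ f ∈ homogComp ℓ n d, f ∈ Jdeal r n ℓ := by
  intro f hf
  rw [f.as_sum]
  refine Ideal.sum_mem _ fun E hE => monomial_mem_Jdeal hr hn E ?_ _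
  have hw := hf (MvPolynomial.mem_support_iff.1 hE)
  have hsum : ∑ i, d i = ∑ p, E p := by
    rw [← hw, Finsupp.weight_apply, Finsupp.sum_fintype _ _ (by simp)]
    simp only [Finset.sum_apply, Pi.smul_apply, smul_eq_mul]
    rw [Finset.sum_comm]
    simp [← Finset.mul_sum]
  exact hsum ▸ hd

end
end

section
/- For all integers n ≥ 1 and ℓ ≥ 1, Σ_{β ∈ D_n} ∏_{k=1}^{n−1} binom(a_k(β) + ℓ − 1, ℓ − 1) = (1/(ℓn + 1))·binom((ℓ+1)n, n), where the sum is over all Dyck paths β of height n. -/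
open scoped Classical

noncomputable section

/-- A Dyck path of height `n`, encoded by its numbers of east steps at each level: a function
`a : Fin (n+1) → ℕ` with `Σ a = n` (the path ends at `(n,n)`) and, for each level `k < n`,
`a 0 + … + a k ≤ k` (every point `(x,y)` of the path satisfies `x ≤ y`).  Here `a k` is the
number of east steps at level `k`, i.e. `a_k(β)`. -/
def DyckEnc (n : ℕ) : Type :=
  {a : Fin (n + 1) → ℕ // (∑ k, a k) = n ∧
    ∀ k : Fin (n + 1), (k : ℕ) < n →
      (∑ j ∈ Finset.univ.filter (fun j : Fin (n + 1) => j ≤ k), a j) ≤ (k : ℕ)}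

/-- The sequences `a 0, …, a m` with sum `s` and partial sums `a 0 + … + a k ≤ k`. -/
def ballotSequences (m s : ℕ) : Finset (Fin (m + 1) → ℕ) :=
  (Finset.piAntidiag Finset.univ s).filter fun a =>
    ∀ k : Fin (m + 1), ∑ j with j ≤ k, a j ≤ (k : ℕ)

theorem mem_ballotSequences {m s : ℕ} {a : Fin (m + 1) → ℕ} :
    a ∈ ballotSequences m s ↔
      ∑ k, a k = s ∧ ∀ k : Fin (m + 1), ∑ j with j ≤ k, a j ≤ (k : ℕ) := by
  simp [ballotSequences, Finset.mem_piAntidiag]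

theorem sum_filter_le_last {m : ℕ} (a : Fin (m + 1) → ℕ) :
    ∑ j with j ≤ Fin.last m, a j = ∑ j, a j := by
  simp [Fin.le_last]

theorem sum_filter_le_castSucc {m : ℕ} (a : Fin (m + 2) → ℕ) (k : Fin (m + 1)) :
    ∑ j with j ≤ k.castSucc, a j = ∑ j with j ≤ k, Fin.init a j := by
  rw [Finset.sum_filter, Finset.sum_filter, Fin.sum_univ_castSucc]
  simp [Fin.init, (Fin.castSucc_lt_last k).not_ge]

theorem mem_ballotSequences_succ {m s : ℕ} (hs : s ≤ m + 1) {a : Fin (m + 2) → ℕ} :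
    a ∈ ballotSequences (m + 1) s ↔
      ∃ t, t + a (Fin.last _) = s ∧ Fin.init a ∈ ballotSequences m t := by
  simp only [mem_ballotSequences]
  rw [Fin.forall_fin_succ', sum_filter_le_last, Fin.sum_univ_castSucc]
  simp only [sum_filter_le_castSucc, Fin.val_castSucc, Fin.val_last]
  constructor
  · rintro ⟨h, hk, -⟩
    exact ⟨_, h, rfl, hk⟩
  · rintro ⟨t, h, ht, hk⟩
    have h' : ∑ i : Fin (m + 1), a i.castSucc + a (Fin.last (m + 1)) = s := by
      rw [← h, ← ht]; rfl
    exact ⟨h', hk, h'.trans_le hs⟩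

theorem ballotSequences_eq_empty {m s : ℕ} (hs : m < s) : ballotSequences m s = ∅ := by
  refine Finset.eq_empty_of_forall_notMem fun a ha => ?_
  rw [mem_ballotSequences] at ha
  have := ha.2 (Fin.last m)
  rw [sum_filter_le_last, ha.1, Fin.val_last] at this
  omega

theorem sum_ballotSequences_succ {m s : ℕ} (hs : s ≤ m + 1) (F : (Fin (m + 1) → ℕ) → ℕ → ℚ) :
    ∑ a ∈ ballotSequences (m + 1) s, F (Fin.init a) (a (Fin.last _)) =
      ∑ p ∈ Finset.HasAntidiagonal.antidiagonal s, ∑ b ∈ ballotSequences m p.1, F b p.2 := by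
  rw [Finset.sum_sigma']
  refine Finset.sum_bij' (fun a _ => ⟨(s - a (Fin.last _), a (Fin.last _)), Fin.init a⟩)
    (fun x _ => Fin.snoc (α := fun _ => ℕ) x.2 x.1.2) ?_ ?_ ?_ ?_ ?_
  · intro a ha
    obtain ⟨t, rfl, ht⟩ := (mem_ballotSequences_succ hs).1 ha
    simpa using ht
  · rintro ⟨⟨t, r⟩, b⟩ hb
    simp only [Finset.mem_sigma, Finset.HasAntidiagonal.mem_antidiagonal] at hb
    rw [mem_ballotSequences_succ hs]
    exact ⟨t, by simpa using hb.1, by simpa using hb.2⟩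
  · intro a _
    simp
  · rintro ⟨⟨t, r⟩, b⟩ hb
    simp only [Finset.mem_sigma, Finset.HasAntidiagonal.mem_antidiagonal] at hb
    obtain ⟨rfl, -⟩ := hb
    simp
  · intro a _
    rfl

/-- The ballot numbers for paths with slope parameter `q + 1`. -/
def ballotNumber (q j : ℕ) : ℕ → ℚ
  | 0 => 1
  | s + 1 => (j + q + (s + 1)).choose (s + 1) - (q + 1) * (j + q + (s + 1)).choose s

theorem ballotNumber_succ_succ (q j s : ℕ) :
    ballotNumber q (j + 1) (s + 1) = ballotNumber q j (s + 1) + ballotNumber q (j + 1) s := by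
  have e1 : j + 1 + q + (s + 1) = (j + q + (s + 1)) + 1 := by ring
  cases s with
  | zero => simp [ballotNumber]
  | succ s =>
    have e2 : j + 1 + q + (s + 1) = j + q + (s + 1 + 1) := by ring
    simp only [ballotNumber]
    rw [e1, Nat.choose_succ_succ, Nat.choose_succ_succ _ s, e2]
    push_cast
    ring

theorem ballotNumber_eq_zero (q m : ℕ) : ballotNumber q ((q + 1) * m) (m + 1) = 0 := by
  have h := Nat.choose_succ_right_eq ((q + 1) * m + q + (m + 1)) m
  rw [show (q + 1) * m + q + (m + 1) - m = (q + 1) * (m + 1) by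
    apply Nat.sub_eq_of_eq_add; ring] at h
  have h' : ((q + 1) * m + q + (m + 1)).choose (m + 1) =
      (q + 1) * ((q + 1) * m + q + (m + 1)).choose m := by
    apply Nat.eq_of_mul_eq_mul_right (Nat.succ_pos m)
    rw [h, Nat.succ_eq_add_one]; ring
  rw [ballotNumber, h']
  push_cast
  ring

open PowerSeries in
theorem one_sub_X_mul_mk_ballotNumber (q j : ℕ) :
    (1 - X) * mk (ballotNumber q (j + 1)) = mk (ballotNumber q j) := by
  ext s
  cases s with
  | zero => simp [sub_mul, ballotNumber]
  | succ s => simp [sub_mul, coeff_succ_X_mul, ballotNumber_succ_succ]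

open PowerSeries in
theorem mk_ballotNumber_add (q j p : ℕ) :
    mk (ballotNumber q (j + p)) = mk (ballotNumber q j) * (invOneSubPow ℚ p : ℚ⟦X⟧) := by
  have h : (1 - X) ^ p * mk (ballotNumber q (j + p)) = mk (ballotNumber q j) := by
    induction p with
    | zero => simp
    | succ p ih =>
      rw [pow_succ, mul_assoc, ← add_assoc, one_sub_X_mul_mk_ballotNumber, ih]
  rw [← h, ← invOneSubPow_inv_eq_one_sub_pow, mul_right_comm]
  simp

theorem ballotNumber_add_succ (q j p s : ℕ) :
    ballotNumber q (j + (p + 1)) s =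
      ∑ x ∈ Finset.HasAntidiagonal.antidiagonal s, ballotNumber q j x.1 * ((x.2 + p).choose p : ℚ) := by
  have h := congrArg (PowerSeries.coeff s) (mk_ballotNumber_add q j (p + 1))
  rw [PowerSeries.coeff_mul, PowerSeries.invOneSubPow_val_succ_eq_mk_add_choose] at h
  simpa [add_comm] using h

theorem sum_ballotSequences_prod_choose (q m s : ℕ) (hs : s ≤ m + 1) :
    ∑ a ∈ ballotSequences m s, ∏ k : Fin m, ((a k.succ + q).choose q : ℚ) =
      ballotNumber q ((q + 1) * m) s := by
  induction m generalizing s with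
  | zero =>
    obtain rfl | rfl : s = 0 ∨ s = 1 := by omega
    · have : ballotSequences 0 0 = {0} := by
        ext a
        simp [mem_ballotSequences, funext_iff, Fin.forall_fin_one]
      simp [this, ballotNumber]
    · rw [ballotSequences_eq_empty one_pos, ballotNumber_eq_zero, Finset.sum_empty]
  | succ m ih =>
    obtain hs | rfl : s ≤ m + 1 ∨ s = m + 1 + 1 := by omega
    · rw [mul_add_one, ballotNumber_add_succ]
      have := sum_ballotSequences_succ hs fun b r =>
        (∏ k : Fin m, ((b k.succ + q).choose q : ℚ)) * ((r + q).choose q : ℚ)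
      simp only [Fin.prod_univ_castSucc]
      refine this.trans (Finset.sum_congr rfl fun x hx => ?_)
      rw [← Finset.sum_mul, ih]
      exact ((Nat.le_add_right _ _).trans_eq (Finset.HasAntidiagonal.mem_antidiagonal.1 hx)).trans hs
    · rw [ballotSequences_eq_empty (Nat.lt_succ_self _), ballotNumber_eq_zero, Finset.sum_empty]

theorem ballotNumber_eq_fussCatalan (q m : ℕ) :
    ballotNumber q ((q + 1) * m + 1) (m + 1) =
      1 / (((q + 1 : ℕ) : ℚ) * (m + 1 : ℕ) + 1) *
        (((q + 1 + 1) * (m + 1)).choose (m + 1) : ℚ) := by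
  have e : (q + 1) * m + 1 + q + (m + 1) = (q + 1 + 1) * (m + 1) := by ring
  have h := Nat.choose_succ_right_eq ((q + 1 + 1) * (m + 1)) m
  rw [show (q + 1 + 1) * (m + 1) - m = (q + 1) * (m + 1) + 1 by
    apply Nat.sub_eq_of_eq_add; ring] at h
  rw [ballotNumber, e]
  have h' := congrArg (Nat.cast : ℕ → ℚ) h
  push_cast at h' ⊢
  have : ((q : ℚ) + 1) * (m + 1) + 1 ≠ 0 := by positivity
  field_simp
  linear_combination ((q : ℚ) + 1) * h'

theorem mem_ballotSequences_self {n : ℕ} {a : Fin (n + 1) → ℕ} :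
    a ∈ ballotSequences n n ↔ (∑ k, a k) = n ∧ ∀ k : Fin (n + 1), (k : ℕ) < n →
      (∑ j ∈ Finset.univ.filter (fun j : Fin (n + 1) => j ≤ k), a j) ≤ (k : ℕ) := by
  rw [mem_ballotSequences]
  refine and_congr_right fun h => ⟨fun hk k _ => hk k, fun hk k => ?_⟩
  obtain hlt | heq := (Nat.lt_succ_iff.1 k.isLt).lt_or_eq
  · exact hk k hlt
  · obtain rfl : k = Fin.last n := Fin.ext heq
    rw [sum_filter_le_last, h, Fin.val_last]

theorem finsum_dyckEnc (n : ℕ) (F : (Fin (n + 1) → ℕ) → ℚ) :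
    ∑ᶠ β : DyckEnc n, F β.val = ∑ a ∈ ballotSequences n n, F a := by
  rw [← finsum_mem_finset_eq_sum, ← finsum_subtype_eq_finsum_cond]
  exact finsum_eq_of_bijective _
    (Equiv.subtypeEquivRight fun _ => mem_ballotSequences_self.symm).bijective fun _ => rfl

/-- For all `n, ℓ ≥ 1`,
`Σ_{β ∈ D_n} ∏_{k=1}^{n-1} C(a_k(β) + ℓ - 1, ℓ - 1) = (1/(ℓn+1))·C((ℓ+1)n, n)`,
the Fuss–Catalan number. -/
theorem statement14 (n ℓ : ℕ) (hn : 1 ≤ n) (hℓ : 1 ≤ ℓ) :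
    (∑ᶠ β : DyckEnc n, ∏ k : Fin (n - 1),
        (Nat.choose (β.val ⟨(k : ℕ) + 1, by have := k.isLt; omega⟩ + ℓ - 1) (ℓ - 1) : ℚ)) =
      (1 / ((ℓ : ℚ) * n + 1)) * (Nat.choose ((ℓ + 1) * n) n : ℚ) := by
  obtain ⟨m, rfl⟩ := Nat.exists_eq_add_of_le' hn
  obtain ⟨q, rfl⟩ := Nat.exists_eq_add_of_le' hℓ
  rw [← ballotNumber_eq_fussCatalan, ballotNumber_add_succ q _ 0]
  refine (finsum_dyckEnc (m + 1) fun a => ∏ k : Fin m,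
    ((Fin.init a k.succ + q).choose q : ℚ)).trans ?_
  refine (sum_ballotSequences_succ le_rfl fun b _ =>
    ∏ k : Fin m, ((b k.succ + q).choose q : ℚ)).trans ?_
  refine Finset.sum_congr rfl fun x hx => ?_
  rw [sum_ballotSequences_prod_choose q m _
    ((Nat.le_add_right _ _).trans_eq (Finset.HasAntidiagonal.mem_antidiagonal.1 hx))]
  simp

end
end
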